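/- arXiv:1406.3152 — 2 statements merged into one kernel-verified Lean document; each statement's English description precedes it below -/
import Mathlib

section
/- Let G be an Archimedean abelian ℓ-group with a strong unit u and let m be a maximal ideal of G. Then there exists a unique map φ : G → ℝ that is a group homomorphism preserving ⊓ and ⊔, satisfies φ(u) = 1, and whose kernel φ⁻¹({0}) equals m. (This is part (a) of the Yosida representation: the quotient G/m admits a unique unital ℓ-group embedding into (ℝ,1).) -/
/-- The absolute value `|g| = (g ⊔ 0) + ((-g) ⊔ 0)` in a lattice-ordered abelian group. -/
def absl {A : Type*} [Lattice A] [AddCommGroup A] (g : A) : A :=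
  (g ⊔ 0) + (-g ⊔ 0)

/-- An ideal of an abelian ℓ-group: an order-convex sublattice subgroup. -/
structure IsIdeal {A : Type*} [Lattice A] [AddCommGroup A] (I : Set A) : Prop where
  zero_mem : (0 : A) ∈ I
  add_mem : ∀ ⦃a b : A⦄, a ∈ I → b ∈ I → a + b ∈ I
  neg_mem : ∀ ⦃a : A⦄, a ∈ I → -a ∈ I
  sup_mem : ∀ ⦃a b : A⦄, a ∈ I → b ∈ I → a ⊔ b ∈ I
  inf_mem : ∀ ⦃a b : A⦄, a ∈ I → b ∈ I → a ⊓ b ∈ I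
  convex : ∀ ⦃a b c : A⦄, a ∈ I → c ∈ I → a ≤ b → b ≤ c → b ∈ I

/-- A maximal ideal: a proper ideal that is inclusion-maximal among proper ideals. -/
def IsMaximalIdeal {A : Type*} [Lattice A] [AddCommGroup A] (m : Set A) : Prop :=
  IsIdeal m ∧ m ≠ Set.univ ∧
    ∀ I : Set A, IsIdeal I → I ≠ Set.univ → m ⊆ I → I = m

/-- `A` is Archimedean: whenever `0 ≤ n • g ≤ h` for all integers `n ≥ 1`, then `g = 0`. -/
def IsArch (A : Type*) [Lattice A] [AddCommGroup A] : Prop :=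
  ∀ g h : A, (∀ n : ℕ, 1 ≤ n → 0 ≤ n • g ∧ n • g ≤ h) → g = 0

theorem y10_bound {G : Type*} [Lattice G] [AddCommGroup G] [IsOrderedAddMonoid G]
    {m : Set G} (hm : IsMaximalIdeal m) {a : G} (ha : 0 ≤ a) (ham : a ∉ m) (b : G) :
    ∃ n : ℕ, ∃ p ∈ m, 0 ≤ p ∧ b ≤ n • a + p := by
  obtain ⟨hI, hne, hmax⟩ := hm
  let I : Set G := {g | ∃ n : ℕ, ∃ p ∈ m, 0 ≤ p ∧ g ≤ n • a + p ∧ -g ≤ n • a + p}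
  have comb : ∀ {x y : G}, x ∈ I → y ∈ I → ∃ B₁ B₂ : G, 0 ≤ B₁ ∧ 0 ≤ B₂ ∧
      x ≤ B₁ ∧ -x ≤ B₁ ∧ y ≤ B₂ ∧ -y ≤ B₂ ∧
      ∀ z, z ≤ B₁ + B₂ → -z ≤ B₁ + B₂ → z ∈ I := by
    rintro x y ⟨n, p, hp, hp0, h1, h2⟩ ⟨k, q, hq, hq0, h3, h4⟩
    refine ⟨_, _, add_nonneg (nsmul_nonneg ha n) hp0, add_nonneg (nsmul_nonneg ha k) hq0,
      h1, h2, h3, h4, ?_⟩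
    intro z hz hz'
    have e : n • a + p + (k • a + q) = (n + k) • a + (p + q) := by rw [add_nsmul]; abel
    rw [e] at hz hz'
    exact ⟨n + k, p + q, hI.add_mem hp hq, add_nonneg hp0 hq0, hz, hz'⟩
  have hII : IsIdeal I := by
    refine ⟨⟨0, 0, hI.zero_mem, le_rfl, by simp, by simp⟩, ?_, ?_, ?_, ?_, ?_⟩
    · intro x y hx hy
      obtain ⟨B, C, hB, hC, h1, h2, h3, h4, h⟩ := comb hx hy
      exact h _ (add_le_add h1 h3) (by rw [neg_add]; exact add_le_add h2 h4)
    · rintro x ⟨n, p, hp, hp0, h1, h2⟩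
      exact ⟨n, p, hp, hp0, h2, by simpa using h1⟩
    · intro x y hx hy
      obtain ⟨B, C, hB, hC, h1, h2, h3, h4, h⟩ := comb hx hy
      refine h _ (sup_le (h1.trans (le_add_of_nonneg_right hC))
        (h3.trans (le_add_of_nonneg_left hB))) ?_
      exact (neg_le_neg le_sup_left).trans (h2.trans (le_add_of_nonneg_right hC))
    · intro x y hx hy
      obtain ⟨B, C, hB, hC, h1, h2, h3, h4, h⟩ := comb hx hy
      refine h _ (inf_le_left.trans (h1.trans (le_add_of_nonneg_right hC))) ?_
      rw [neg_inf]
      exact sup_le (h2.trans (le_add_of_nonneg_right hC)) (h4.trans (le_add_of_nonneg_left hB))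
    · intro x z y hx hy hxz hzy
      obtain ⟨B, C, hB, hC, h1, h2, h3, h4, h⟩ := comb hx hy
      exact h _ (hzy.trans (h3.trans (le_add_of_nonneg_left hB)))
        ((neg_le_neg hxz).trans (h2.trans (le_add_of_nonneg_right hC)))
  have hmI : m ⊆ I := by
    intro x hx
    refine ⟨0, |x|, hI.sup_mem hx (hI.neg_mem hx), abs_nonneg x, ?_, ?_⟩
    · simpa using le_abs_self x
    · simpa using neg_le_abs x
  have haI : a ∈ I := by
    refine ⟨1, 0, hI.zero_mem, le_rfl, by simp, ?_⟩
    simpa using (neg_nonpos.mpr ha).trans ha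
  have hu : I = Set.univ := by
    by_contra hcon
    rw [hmax I hII hcon hmI] at haI
    exact ham haI
  have hb : b ∈ I := by rw [hu]; trivial
  obtain ⟨n, p, hp, hp0, h1, -⟩ := hb
  exact ⟨n, p, hp, hp0, h1⟩

theorem y10_prime {G : Type*} [Lattice G] [AddCommGroup G] [IsOrderedAddMonoid G]
    {m : Set G} (hm : IsMaximalIdeal m) {a b : G} (hab : a ⊓ b = 0) : a ∈ m ∨ b ∈ m := by
  have ha : 0 ≤ a := hab ▸ inf_le_left
  have hb : 0 ≤ b := hab ▸ inf_le_right
  by_cases ham : a ∈ m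
  · exact Or.inl ham
  right
  obtain ⟨n, p, hp, hp0, h⟩ := y10_bound hm ha ham b
  refine hm.1.convex hm.1.zero_mem hp hb ?_
  induction n with
  | zero => simpa using h
  | succ n ih =>
    apply ih
    have hq : 0 ≤ n • a + p := add_nonneg (nsmul_nonneg ha n) hp0
    have h1 : b - (n • a + p) ≤ a := by
      rw [sub_le_iff_le_add]
      calc b ≤ _ := h
        _ = _ := by rw [succ_nsmul]; abel
    have h2 : b - (n • a + p) ≤ b := sub_le_self _ hq
    have h3 := le_inf h1 h2
    rw [hab] at h3
    exact sub_nonpos.mp h3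

theorem y10_embed (H : Type*) [AddCommGroup H] [LinearOrder H] [IsOrderedAddMonoid H]
    [Archimedean H] (e : H) (he : 0 < e) :
    ∃ f : H →+o ℝ, Function.Injective f ∧ f e = 1 := by
  let one : One H := ⟨e⟩
  have : ZeroLEOneClass H := ⟨he.le⟩
  have : NeZero (1 : H) := ⟨he.ne'⟩
  exact ⟨Archimedean.embedReal H, Archimedean.embedReal_injective H, Archimedean.embedReal_one⟩

theorem y10_exists {G : Type*} [Lattice G] [AddCommGroup G] [IsOrderedAddMonoid G]
    (u : G) (hu0 : 0 ≤ u) {m : Set G} (hm : IsMaximalIdeal m) (hum : u ∉ m) :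
    ∃ φ : G →+ ℝ, Monotone φ ∧ φ u = 1 ∧ ∀ g, φ g = 0 ↔ g ∈ m := by
  classical
  let M : AddSubgroup G :=
    { carrier := m, zero_mem' := hm.1.zero_mem, add_mem' := fun h h' => hm.1.add_mem h h',
      neg_mem' := fun h => hm.1.neg_mem h }
  have hMm : ∀ g : G, g ∈ M ↔ g ∈ m := fun g => Iff.rfl
  let C : AddGroupCone (G ⧸ M) :=
    { carrier := {x | ∃ g : G, 0 ≤ g ∧ QuotientAddGroup.mk' M g = x}
      zero_mem' := ⟨0, le_rfl, by simp⟩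
      add_mem' := by
        rintro _ _ ⟨g, hg, rfl⟩ ⟨h, hh, rfl⟩
        exact ⟨g + h, add_nonneg hg hh, by simp⟩
      eq_zero_of_mem_of_neg_mem' := by
        rintro _ ⟨g, hg, rfl⟩ ⟨h, hh, e⟩
        have : QuotientAddGroup.mk' M (g + h) = 0 := by rw [map_add, e]; simp
        rw [← AddMonoidHom.mem_ker, QuotientAddGroup.ker_mk', hMm] at this
        rw [← AddMonoidHom.mem_ker, QuotientAddGroup.ker_mk', hMm]
        exact hm.1.convex hm.1.zero_mem this hg (le_add_of_nonneg_right hh) }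
  have hC : ∀ x, x ∈ C ↔ ∃ g : G, 0 ≤ g ∧ QuotientAddGroup.mk' M g = x := fun x => Iff.rfl
  have hker : ∀ g, QuotientAddGroup.mk' M g = 0 ↔ g ∈ m := fun g => by
    rw [← AddMonoidHom.mem_ker, QuotientAddGroup.ker_mk', hMm]
  have htot : HasMemOrNegMem C := by
    refine ⟨fun x => ?_⟩
    obtain ⟨g, rfl⟩ := QuotientAddGroup.mk'_surjective M x
    have hg : QuotientAddGroup.mk' M g
        = QuotientAddGroup.mk' M g⁺ - QuotientAddGroup.mk' M g⁻ := by
      rw [← map_sub, posPart_sub_negPart]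
    rcases y10_prime hm (posPart_inf_negPart_eq_zero g) with h | h
    · right
      exact ⟨g⁻, negPart_nonneg g, by rw [hg, (hker _).2 h]; simp⟩
    · left
      exact ⟨g⁺, posPart_nonneg g, by rw [hg, (hker _).2 h]; simp⟩
  letI : LinearOrder (G ⧸ M) := LinearOrder.mkOfAddGroupCone C
  haveI : IsOrderedAddMonoid (G ⧸ M) := IsOrderedAddMonoid.mkOfCone C
  have hle : ∀ x y : G ⧸ M, x ≤ y ↔ y - x ∈ C := fun x y => Iff.rfl
  have hmono : ∀ a b : G, a ≤ b → QuotientAddGroup.mk' M a ≤ QuotientAddGroup.mk' M b := by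
    intro a b h
    rw [hle, hC]
    exact ⟨b - a, sub_nonneg.mpr h, map_sub _ _ _⟩
  haveI : Archimedean (G ⧸ M) := by
    refine ⟨fun x y hy => ?_⟩
    obtain ⟨b, rfl⟩ := QuotientAddGroup.mk'_surjective M x
    obtain ⟨a, ha, e⟩ := (hC _).1 ((hle _ _).1 hy.le)
    rw [sub_zero] at e
    subst e
    have ham : a ∉ m := fun h => hy.ne' ((hker a).2 h)
    obtain ⟨n, p, hp, -, h⟩ := y10_bound hm ha ham b
    refine ⟨n, ?_⟩
    have := hmono _ _ h
    rwa [map_add, (hker p).2 hp, add_zero, map_nsmul] at this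
  have hpos : 0 < QuotientAddGroup.mk' M u := by
    refine lt_of_le_of_ne ?_ (fun h => hum ((hker u).1 h.symm))
    have := hmono 0 u hu0
    rwa [map_zero] at this
  obtain ⟨f, hf, hf1⟩ := y10_embed (G ⧸ M) _ hpos
  refine ⟨(f : (G ⧸ M) →+ ℝ).comp (QuotientAddGroup.mk' M), ?_, hf1, ?_⟩
  · intro a b h
    exact f.monotone' (hmono a b h)
  · intro g
    rw [← hker]
    exact map_eq_zero_iff f hf

theorem y10_le {G : Type*} [Lattice G] [AddCommGroup G] (u : G) {m : Set G} (φ ψ : G →+ ℝ)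
    (h1 : ∀ a b : G, φ (a ⊔ b) = φ a ⊔ φ b) (h2 : ∀ a b : G, ψ (a ⊔ b) = ψ a ⊔ ψ b)
    (hu1 : φ u = 1) (hu2 : ψ u = 1) (hk1 : φ ⁻¹' {0} = m) (hk2 : ψ ⁻¹' {0} = m) (a : G) :
    ψ a ≤ φ a := by
  by_contra! hlt
  obtain ⟨q, hq1, hq2⟩ := exists_rat_btwn hlt
  have hd : (0 : ℝ) < q.den := by exact_mod_cast q.den_pos
  have hqe : (q : ℝ) = q.num / q.den := Rat.cast_def q
  rw [hqe] at hq1 hq2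
  rw [lt_div_iff₀ hd] at hq1
  rw [div_lt_iff₀ hd] at hq2
  have e1 : φ (q.den • a - q.num • u) = q.den * φ a - q.num := by simp [hu1]
  have e2 : ψ (q.den • a - q.num • u) = q.den * ψ a - q.num := by simp [hu2]
  have k : (q.den • a - q.num • u) ⊔ 0 ∈ m := by
    rw [← hk1, Set.mem_preimage, Set.mem_singleton_iff, h1, map_zero, e1]
    exact sup_eq_right.2 (by linarith)
  rw [← hk2, Set.mem_preimage, Set.mem_singleton_iff, h2, map_zero, e2] at k
  have := sup_eq_right.1 k
  linarith

/-- Yosida representation, part (a): for each maximal ideal `m` of an Archimedean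
abelian ℓ-group with strong unit `u`, there is a unique unital ℓ-homomorphism
`φ : G → ℝ` whose kernel is `m`. -/
theorem statement10 {G : Type*} [Lattice G] [AddCommGroup G]
    [CovariantClass G G (· + ·) (· ≤ ·)]
    (harch : IsArch G)
    (u : G) (hu0 : 0 ≤ u) (hu : ∀ g : G, ∃ n : ℕ, 1 ≤ n ∧ g ≤ n • u)
    (m : Set G) (hm : IsMaximalIdeal m) :
    ∃! φ : G → ℝ,
      (∀ a b : G, φ (a + b) = φ a + φ b) ∧
      (∀ a b : G, φ (a ⊓ b) = φ a ⊓ φ b) ∧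
      (∀ a b : G, φ (a ⊔ b) = φ a ⊔ φ b) ∧
      φ u = 1 ∧
      φ ⁻¹' {0} = m := by
  haveI : IsOrderedAddMonoid G :=
    { add_le_add_left := fun a b h c => by
        rw [add_comm a c, add_comm b c]
        exact CovariantClass.elim (μ := fun x y : G => x + y) (r := (· ≤ ·)) c h }
  have hum : u ∉ m := by
    intro hum
    refine hm.2.1 (Set.eq_univ_of_forall fun g => ?_)
    have hn : ∀ n : ℕ, n • u ∈ m := by
      intro n
      induction n with
      | zero => rw [zero_nsmul]; exact hm.1.zero_mem
      | succ n ih => rw [succ_nsmul]; exact hm.1.add_mem ih hum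
    obtain ⟨n, -, h1⟩ := hu g
    obtain ⟨k, -, h2⟩ := hu (-g)
    exact hm.1.convex (hm.1.neg_mem (hn k)) (hn n) (neg_le.mp h2) h1
  obtain ⟨φ, hmono, hφu, hker⟩ := y10_exists u hu0 hm hum
  have hsup : ∀ a b : G, φ (a ⊔ b) = φ a ⊔ φ b := by
    intro a b
    refine le_antisymm ?_ (sup_le (hmono le_sup_left) (hmono le_sup_right))
    have hd : (a ⊔ b - a) ⊓ (a ⊔ b - b) = 0 := by
      rw [← sub_sup, sub_self]
    rcases y10_prime hm hd with h | h
    · have := (hker _).2 h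
      rw [map_sub, sub_eq_zero] at this
      rw [this]; exact le_sup_left
    · have := (hker _).2 h
      rw [map_sub, sub_eq_zero] at this
      rw [this]; exact le_sup_right
  have hinf : ∀ a b : G, φ (a ⊓ b) = φ a ⊓ φ b := by
    intro a b
    have h1 : φ (a ⊓ b) + φ (a ⊔ b) = φ a + φ b := by rw [← map_add, inf_add_sup, map_add]
    have h2 := inf_add_sup (φ a) (φ b)
    rw [hsup] at h1
    linarith
  have hk : φ ⁻¹' {0} = m := by
    ext g
    exact hker g
  refine ⟨φ, ⟨map_add φ, hinf, hsup, hφu, hk⟩, ?_⟩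
  rintro ψ ⟨hadd, -, hsup', hψu, hk'⟩
  let Ψ : G →+ ℝ := AddMonoidHom.mk' ψ hadd
  funext a
  exact le_antisymm (y10_le u φ Ψ hsup hsup' hφu hψu hk hk' a)
    (y10_le u Ψ φ hsup' hsup hψu hφu hk' hk a)
end

section
/- Let H be an abelian ℓ-group with a strong unit v such that for every x ∈ H every element g ∈ H can be written g = a + b with a ∈ x^⊥⊥ and b ∈ x^⊥ (as holds in every projectable Archimedean ℓ-group), and for h ∈ H let σ_h denote the unique component of v with σ_h^⊥⊥ = h^⊥⊥. Then σ_0 = 0, σ_v = v, and for all h₁, h₂ ∈ H with h₁, h₂ ≥ 0 one has σ_{h₁ ⊓ h₂} = σ_{h₁} ⊓ σ_{h₂} and σ_{h₁ ⊔ h₂} = σ_{h₁} ⊔ σ_{h₂}; that is, h ↦ σ_h is a lattice homomorphism on the positive cone. -/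
/-- The polar `T^⊥ = {x : |x| ⊓ |t| = 0 for all t ∈ T}`. -/
def polar {A : Type*} [Lattice A] [AddCommGroup A] (T : Set A) : Set A :=
  {x : A | ∀ t ∈ T, absl x ⊓ absl t = 0}

/-- A component of `u`: an element `χ` with `χ ⊓ (u - χ) = 0` and `χ ⊔ (u - χ) = u`. -/
def IsComponent {A : Type*} [Lattice A] [AddCommGroup A] (u χ : A) : Prop :=
  χ ⊓ (u - χ) = 0 ∧ χ ⊔ (u - χ) = u

section helpers
variable {A : Type*} [Lattice A] [AddCommGroup A]

theorem aux_triple (T : Set A) : polar (polar (polar T)) = polar T := by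
  ext x
  constructor
  · intro hx t ht
    refine hx t ?_
    intro s hs
    rw [inf_comm]
    exact hs t ht
  · intro hx t ht
    rw [inf_comm]
    exact ht x hx

variable [CovariantClass A A (· + ·) (· ≤ ·)]

theorem aux_absl {x : A} (hx : 0 ≤ x) : absl x = x := by
  have h : -x ≤ 0 := by simpa using hx
  rw [absl, sup_eq_left.2 hx, sup_eq_right.2 h, add_zero]

theorem aux_distl (x y z : A) : x ⊓ (y ⊔ z) = (x ⊓ y) ⊔ (x ⊓ z) := by
  letI : DistribLattice A := AddCommGroup.toDistribLattice A
  exact inf_sup_left x y z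

theorem aux_sup_zero {x y : A} (hx : 0 ≤ x) (hy : 0 ≤ y) : x ⊔ y = 0 ↔ x = 0 ∧ y = 0 := by
  constructor
  · intro h
    exact ⟨le_antisymm (h ▸ le_sup_left) hx, le_antisymm (h ▸ le_sup_right) hy⟩
  · rintro ⟨rfl, rfl⟩
    simp

theorem aux_nonneg {v a : A} (h : a ⊓ (v - a) = 0) : 0 ≤ a ∧ 0 ≤ v - a :=
  ⟨h ▸ inf_le_left, h ▸ inf_le_right⟩

theorem aux_le {v a b : A} (ha : a ⊓ (v - a) = 0) (hb : b ⊓ (v - b) = 0)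
    (h : (v - a) ⊓ b = 0) : b ≤ a := by
  have h1 : b ≤ v := sub_nonneg.1 (aux_nonneg hb).2
  have h2 : (v - a) + b = (v - a) ⊔ b := by
    rw [← inf_add_sup, h, zero_add]
  have h3 : (v - a) + b ≤ v := by
    rw [h2]
    exact sup_le (sub_le_self _ (aux_nonneg ha).1) h1
  have h4 : (v - a) + b ≤ (v - a) + a := by simpa using h3
  exact le_of_add_le_add_left h4

theorem aux_eq {v a b : A} (ha : a ⊓ (v - a) = 0) (hb : b ⊓ (v - b) = 0)
    (h : ∀ x : A, 0 ≤ x → (x ⊓ a = 0 ↔ x ⊓ b = 0)) : a = b := by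
  apply le_antisymm
  · refine aux_le hb ha ((h _ (aux_nonneg hb).2).2 ?_)
    rw [inf_comm, hb]
  · refine aux_le ha hb ((h _ (aux_nonneg ha).2).1 ?_)
    rw [inf_comm, ha]

theorem aux_inf {v a b : A} (ha : a ⊓ (v - a) = 0) (hb : b ⊓ (v - b) = 0) :
    (a ⊓ b) ⊓ (v - a ⊓ b) = 0 := by
  have pa := aux_nonneg ha
  have pb := aux_nonneg hb
  have e : v - a ⊓ b = (v - a) ⊔ (v - b) := by
    simp only [sub_eq_add_neg, neg_inf, add_sup]
  rw [e, aux_distl, aux_sup_zero (le_inf (le_inf pa.1 pb.1) pa.2) (le_inf (le_inf pa.1 pb.1) pb.2)]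
  constructor
  · exact le_antisymm (ha ▸ inf_le_inf_right _ inf_le_left) (le_inf (le_inf pa.1 pb.1) pa.2)
  · exact le_antisymm (hb ▸ inf_le_inf_right _ inf_le_right) (le_inf (le_inf pa.1 pb.1) pb.2)

theorem aux_sup {v a b : A} (ha : a ⊓ (v - a) = 0) (hb : b ⊓ (v - b) = 0) :
    (a ⊔ b) ⊓ (v - (a ⊔ b)) = 0 := by
  have ha' : (v - a) ⊓ (v - (v - a)) = 0 := by rw [sub_sub_cancel, inf_comm, ha]
  have hb' : (v - b) ⊓ (v - (v - b)) = 0 := by rw [sub_sub_cancel, inf_comm, hb]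
  have e : v - (a ⊔ b) = (v - a) ⊓ (v - b) := by
    simp only [sub_eq_add_neg, neg_sup, add_inf]
  have := aux_inf ha' hb'
  rw [← e, sub_sub_cancel, inf_comm] at this
  exact this

theorem aux_polar {a b : A} (ha : 0 ≤ a) (hb : 0 ≤ b)
    (h : polar (polar {a}) = polar (polar {b})) (x : A) (hx : 0 ≤ x) :
    x ⊓ a = 0 ↔ x ⊓ b = 0 := by
  have h' : polar {a} = polar {b} := by rw [← aux_triple {a}, h, aux_triple]
  have := Set.ext_iff.1 h' x
  simpa [polar, aux_absl ha, aux_absl hb, aux_absl hx] using this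

end helpers

/-- Under the decomposition hypothesis, the map `h ↦ σ h` assigning to `h` the
unique component of `v` with `(σ h)^⊥⊥ = h^⊥⊥` satisfies `σ 0 = 0`, `σ v = v`, and
is a lattice homomorphism on the positive cone. -/
theorem statement13 {H : Type*} [Lattice H] [AddCommGroup H]
    [CovariantClass H H (· + ·) (· ≤ ·)]
    (v : H) (hv0 : 0 ≤ v) (hv : ∀ g : H, ∃ n : ℕ, 1 ≤ n ∧ g ≤ n • v)
    (hdec : ∀ x g : H, ∃ a ∈ polar (polar {x}), ∃ b ∈ polar {x}, g = a + b)
    (σ : H → H)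
    (hσ : ∀ h : H, IsComponent v (σ h) ∧ polar (polar {σ h}) = polar (polar {h})) :
    σ 0 = 0 ∧ σ v = v ∧
      ∀ h₁ h₂ : H, 0 ≤ h₁ → 0 ≤ h₂ →
        σ (h₁ ⊓ h₂) = σ h₁ ⊓ σ h₂ ∧ σ (h₁ ⊔ h₂) = σ h₁ ⊔ σ h₂ := by
  have c : ∀ h, σ h ⊓ (v - σ h) = 0 := fun h => (hσ h).1.1
  have p : ∀ h, 0 ≤ σ h := fun h => (aux_nonneg (c h)).1
  have k : ∀ h, 0 ≤ h → ∀ x, 0 ≤ x → (x ⊓ σ h = 0 ↔ x ⊓ h = 0) := fun h hh x hx =>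
    aux_polar (p h) hh (hσ h).2 x hx
  refine ⟨?_, ?_, ?_⟩
  · have := (k 0 le_rfl (σ 0) (p 0)).2 (inf_eq_right.2 (p 0))
    simpa using this
  · exact aux_eq (c v) (by simpa using hv0) (k v hv0)
  · intro h₁ h₂ p₁ p₂
    constructor
    · refine aux_eq (c _) (aux_inf (c _) (c _)) fun x hx => ?_
      rw [k _ (le_inf p₁ p₂) x hx, ← inf_assoc, ← k _ p₂ _ (le_inf hx p₁), inf_right_comm,
        ← k _ p₁ _ (le_inf hx (p _)), inf_right_comm, inf_assoc]
    · refine aux_eq (c _) (aux_sup (c _) (c _)) fun x hx => ?_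
      rw [k _ (p₁.trans le_sup_left) x hx, aux_distl, aux_distl,
        aux_sup_zero (le_inf hx p₁) (le_inf hx p₂),
        aux_sup_zero (le_inf hx (p _)) (le_inf hx (p _)), k _ p₁ x hx, k _ p₂ x hx]
end
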